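/- arXiv:2507.07814 — 2 statements merged into one kernel-verified Lean document; each statement's English description precedes it below -/
import Mathlib

section
/- For every z ∈ ℝⁿ, the spectral norm of the softmax Jacobian satisfies ‖diag(sm(z)) − sm(z) sm(z)ᵀ‖₂ ≤ max_i sm(z)_i, i.e., it is bounded by the largest component of sm(z). -/
open Matrix

/-- The softmax map `sm : ℝⁿ → ℝⁿ`, `sm(z)_i = exp z_i / Σ_j exp z_j`. -/
noncomputable def softmax {n : ℕ} (z : Fin n → ℝ) : Fin n → ℝ :=
  fun i => Real.exp (z i) / ∑ j, Real.exp (z j)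

/-- Spectral norm (largest singular value, i.e. ℓ²→ℓ² operator norm) of a real matrix. -/
noncomputable def specNorm {m n : Type*} [Fintype m] [Fintype n] [DecidableEq n]
    (A : Matrix m n ℝ) : ℝ :=
  ‖LinearMap.toContinuousLinearMap (Matrix.toEuclideanLin A)‖

/-- Centring at the weighted mean only decreases the second moment of a probability vector. -/
theorem sum_mul_sub_mean_sq_le {ι : Type*} [Fintype ι] {p : ι → ℝ} (hp : ∑ i, p i = 1)
    (x : ι → ℝ) : ∑ i, p i * (x i - ∑ j, p j * x j) ^ 2 ≤ ∑ i, p i * x i ^ 2 := by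
  set m := ∑ j, p j * x j with hm
  have key : ∑ i, p i * (x i - m) ^ 2 = ∑ i, p i * x i ^ 2 - m ^ 2 := by
    calc ∑ i, p i * (x i - m) ^ 2
        = ∑ i, (p i * x i ^ 2 - 2 * m * (p i * x i) + m ^ 2 * p i) := by
          congr! 1 with i; ring
      _ = ∑ i, p i * x i ^ 2 - 2 * m * m + m ^ 2 * 1 := by
          rw [Finset.sum_add_distrib, Finset.sum_sub_distrib, ← Finset.mul_sum,
            ← Finset.mul_sum, hp, ← hm]
      _ = _ := by ring
  linarith [sq_nonneg m]

/-- The covariance matrix of a probability vector has spectral norm at most any upper bound of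
the entries of the vector. -/
theorem specNorm_diagonal_sub_vecMulVec_le {ι : Type*} [Fintype ι] [DecidableEq ι] {p : ι → ℝ}
    {M : ℝ} (hp : ∑ i, p i = 1) (hp0 : ∀ i, 0 ≤ p i) (hM0 : 0 ≤ M) (hM : ∀ i, p i ≤ M) :
    specNorm (Matrix.diagonal p - Matrix.vecMulVec p p) ≤ M := by
  refine ContinuousLinearMap.opNorm_le_bound _ hM0 fun x => ?_
  refine (sq_le_sq₀ (norm_nonneg _) (by positivity)).mp ?_
  have happ : ∀ i, (Matrix.toEuclideanLin (Matrix.diagonal p - Matrix.vecMulVec p p) x) i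
      = p i * (x i - ∑ j, p j * x j) := by
    intro i
    simp [Matrix.toLpLin_apply, Matrix.mulVec_diagonal, Matrix.vecMulVec_mulVec,
      dotProduct]
    ring
  rw [mul_pow, LinearMap.coe_toContinuousLinearMap', EuclideanSpace.real_norm_sq_eq,
    EuclideanSpace.real_norm_sq_eq]
  simp only [happ]
  calc ∑ i, (p i * (x i - ∑ j, p j * x j)) ^ 2
      ≤ ∑ i, M * (p i * (x i - ∑ j, p j * x j) ^ 2) := by
        gcongr with i
        rw [mul_pow, sq (p i), mul_assoc]
        exact mul_le_mul_of_nonneg_right (hM i) (mul_nonneg (hp0 i) (sq_nonneg _))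
    _ ≤ M * ∑ i, p i * x i ^ 2 := by
        rw [← Finset.mul_sum]
        exact mul_le_mul_of_nonneg_left (sum_mul_sub_mean_sq_le hp _) hM0
    _ ≤ M * ∑ i, M * x i ^ 2 := by
        gcongr with i
        exact hM i
    _ = M ^ 2 * ∑ i, x i ^ 2 := by rw [← Finset.mul_sum]; ring

theorem softmax_nonneg {n : ℕ} (z : Fin n → ℝ) (i : Fin n) : 0 ≤ softmax z i := by
  unfold softmax; positivity

theorem sum_softmax {n : ℕ} (hn : 0 < n) (z : Fin n → ℝ) : ∑ i, softmax z i = 1 := by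
  have : Nonempty (Fin n) := ⟨⟨0, hn⟩⟩
  unfold softmax
  rw [← Finset.sum_div]
  exact div_self (Finset.sum_pos (fun i _ => Real.exp_pos _) Finset.univ_nonempty).ne'

/-- for every `z ∈ ℝⁿ`, the spectral norm of the softmax Jacobian is
bounded by the largest component of `sm z`:
`‖diag(sm z) − (sm z)(sm z)ᵀ‖₂ ≤ max_i (sm z)_i`. -/
theorem stmt3 {n : ℕ} (hn : 0 < n) (z : Fin n → ℝ) :
    specNorm (Matrix.diagonal (softmax z) - Matrix.vecMulVec (softmax z) (softmax z)) ≤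
      ⨆ i, softmax z i := by
  exact specNorm_diagonal_sub_vecMulVec_le (sum_softmax hn z) (softmax_nonneg z)
    (Real.iSup_nonneg (softmax_nonneg z)) (le_ciSup (Set.finite_range _).bddAbove)
end

section
/- Let x ∈ ℝⁿ be a probability vector, let k be an integer with 1 ≤ k ≤ n−1, and let γ be a real number with 1 ≤ γ ≤ k/4. If g_1(x) ≤ γ · g_k(x), then ‖diag(x) − x xᵀ‖₂ ≤ (1 − √(1 − 4γ/k))/2. -/
open Matrix

/-- `kthLargest x k` is the `(k+1)`-th largest component of `x` (0-indexed `k`). -/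
noncomputable def kthLargest {n : ℕ} (x : Fin n → ℝ) (k : Fin n) : ℝ :=
  x (Tuple.sort x k.rev)

/-- The covariance quadratic form of a probability vector, written as a difference of sums. -/
lemma inner_toEuclideanLin_diagonal_sub_vecMulVec {ι : Type*} [Fintype ι] [DecidableEq ι]
    (x : ι → ℝ) (v : EuclideanSpace ℝ ι) :
    inner ℝ (Matrix.toEuclideanLin (Matrix.diagonal x - Matrix.vecMulVec x x) v) v =
      ∑ i, x i * v i ^ 2 - (∑ i, x i * v i) ^ 2 := by
  simp only [PiLp.inner_apply, Matrix.ofLp_toLpLin, Matrix.toLin'_apply, Matrix.sub_mulVec,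
    Matrix.mulVec_diagonal, Pi.sub_apply, Matrix.vecMulVec_mulVec, Pi.smul_apply,
    RCLike.inner_apply, conj_trivial, mul_sub, Finset.sum_sub_distrib, MulOpposite.smul_eq_mul_unop,
    MulOpposite.unop_op, dotProduct, sq]
  congr 1
  · exact Finset.sum_congr rfl fun i _ => by ring
  · rw [Finset.sum_mul]
    exact Finset.sum_congr rfl fun i _ => by ring

lemma sq_sum_mul_le {ι : Type*} (s : Finset ι) {x : ι → ℝ} (hx : ∀ i, 0 ≤ x i) (v : ι → ℝ) :
    (∑ i ∈ s, x i * v i) ^ 2 ≤ (∑ i ∈ s, x i) * ∑ i ∈ s, x i * v i ^ 2 :=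
  Finset.sum_sq_le_sum_mul_sum_of_sq_le_mul s (fun i _ => hx i)
    (fun i _ => mul_nonneg (hx i) (sq_nonneg _)) fun i _ => le_of_eq (by ring)

/-- If `b` bounds all components of a probability vector other than `x p`, then its variance form
is at most `x p * (1 - x p + b)` times the squared Euclidean norm. -/
lemma variance_le_mul_sum_sq {ι : Type*} [Fintype ι] {x : ι → ℝ}
    (hx : ∀ i, 0 ≤ x i) (hsum : ∑ i, x i = 1) {p : ι} {b : ℝ} (hb : 0 ≤ b) (hbp : b ≤ x p)
    (hle : ∀ i, i ≠ p → x i ≤ b) (v : ι → ℝ) :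
    ∑ i, x i * v i ^ 2 - (∑ i, x i * v i) ^ 2 ≤ x p * (1 - x p + b) * ∑ i, v i ^ 2 := by
  classical
  have split (f : ι → ℝ) : ∑ i, f i = f p + ∑ i ∈ Finset.univ.erase p, f i :=
    (Finset.add_sum_erase _ f (Finset.mem_univ p)).symm
  have hle' : ∀ i ∈ Finset.univ.erase p, x i ≤ b := fun i hi => hle i (Finset.ne_of_mem_erase hi)
  have hcs := sq_sum_mul_le (Finset.univ.erase p) hx v
  rw [split] at hsum
  rw [split fun i => x i * v i ^ 2, split fun i => x i * v i, split fun i => v i ^ 2]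
  set a := x p
  set S := ∑ i ∈ Finset.univ.erase p, x i * v i
  set T := ∑ i ∈ Finset.univ.erase p, x i * v i ^ 2
  set N := ∑ i ∈ Finset.univ.erase p, v i ^ 2
  have hrest : ∑ i ∈ Finset.univ.erase p, x i = 1 - a := by linarith
  rw [hrest] at hcs
  have hT : T ≤ b * N := by
    rw [Finset.mul_sum]
    exact Finset.sum_le_sum fun i hi => mul_le_mul_of_nonneg_right (hle' i hi) (sq_nonneg _)
  have ha : 0 ≤ a := hx p
  have ha1 : 0 ≤ 1 - a := hrest ▸ Finset.sum_nonneg fun i _ => hx i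
  have hN : 0 ≤ N := Finset.sum_nonneg fun i _ => sq_nonneg _
  have hT0 : 0 ≤ T := Finset.sum_nonneg fun i _ => mul_nonneg (hx i) (sq_nonneg _)
  rcases hb.eq_or_lt with rfl | hb
  · have hT1 : T = 0 := by linarith
    have hx0 : ∑ i ∈ Finset.univ.erase p, x i = 0 :=
      Finset.sum_eq_zero fun i hi => le_antisymm (hle' i hi) (hx i)
    have ha2 : a = 1 := by linarith
    have hS : S = 0 := by
      rw [hT1] at hcs
      nlinarith [sq_nonneg S]
    rw [ha2, hT1, hS]
    nlinarith
  · have hLb : 0 ≤ (a - b) * (1 - a) := mul_nonneg (by linarith) ha1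
    have h1 : (a - b) * S ^ 2 ≤ (a - b) * ((1 - a) * T) :=
      mul_le_mul_of_nonneg_left hcs (by linarith)
    have h2 : a * (1 - a + b) * T ≤ a * (1 - a + b) * (b * N) :=
      mul_le_mul_of_nonneg_left hT (by positivity)
    refine le_of_mul_le_mul_left ?_ hb
    nlinarith [mul_nonneg ha (sq_nonneg (b * v p + S))]

/-- Upper bound for the spectral norm of a covariance matrix `diag(x) - x xᵀ`. -/
lemma specNorm_diagonal_sub_vecMulVec_le_s4 {ι : Type*} [Fintype ι] [DecidableEq ι] {x : ι → ℝ}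
    (hx : ∀ i, 0 ≤ x i) (hsum : ∑ i, x i = 1) {p : ι} {b : ℝ} (hb : 0 ≤ b) (hbp : b ≤ x p)
    (hle : ∀ i, i ≠ p → x i ≤ b) :
    specNorm (Matrix.diagonal x - Matrix.vecMulVec x x) ≤ x p * (1 - x p + b) := by
  have hp1 : x p ≤ 1 := hsum ▸ Finset.single_le_sum (fun i _ => hx i) (Finset.mem_univ p)
  have hL : 0 ≤ x p * (1 - x p + b) := mul_nonneg (hx p) (by linarith)
  have hsymm : (Matrix.toEuclideanLin (Matrix.diagonal x - Matrix.vecMulVec x x)).IsSymmetric := by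
    rw [Matrix.isSymmetric_toEuclideanLin_iff]
    ext i j
    by_cases h : i = j
    · simp [h]
    · simp [Matrix.vecMulVec_apply, Matrix.diagonal_apply_ne, h, Ne.symm h, mul_comm]
  rw [specNorm, ContinuousLinearMap.norm_eq_iSup_rayleighQuotient _ hsymm]
  refine ciSup_le fun v => ?_
  rw [ContinuousLinearMap.rayleighQuotient, ContinuousLinearMap.reApplyInnerSelf_apply,
    LinearMap.coe_toContinuousLinearMap', RCLike.re_to_real,
    inner_toEuclideanLin_diagonal_sub_vecMulVec]
  have h0 : 0 ≤ ∑ i, x i * v i ^ 2 - (∑ i, x i * v i) ^ 2 := by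
    simpa [hsum] using sq_sum_mul_le Finset.univ hx v
  rw [abs_of_nonneg (by positivity)]
  refine div_le_of_le_mul₀ (by positivity) hL ?_
  rw [EuclideanSpace.real_norm_sq_eq]
  exact variance_le_mul_sum_sq hx hsum hb hbp hle v

lemma kthLargest_antitone {n : ℕ} (x : Fin n → ℝ) : Antitone (kthLargest x) :=
  fun _ _ hij => Tuple.monotone_sort x (Fin.rev_le_rev.mpr hij)

lemma exists_kthLargest_eq {n : ℕ} (x : Fin n → ℝ) (i : Fin n) :
    ∃ j, kthLargest x j = x i ∧ Tuple.sort x j.rev = i :=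
  ⟨((Tuple.sort x).symm i).rev, by simp [kthLargest], by simp⟩

lemma sum_kthLargest {n : ℕ} (x : Fin n → ℝ) : ∑ j, kthLargest x j = ∑ i, x i :=
  Equiv.sum_comp (Fin.revPerm.trans (Tuple.sort x)) x

lemma succ_mul_kthLargest_le_sum {n : ℕ} {x : Fin n → ℝ} (hx : ∀ i, 0 ≤ x i) (j : Fin n) :
    ((j : ℝ) + 1) * kthLargest x j ≤ ∑ i, x i := by
  rw [← sum_kthLargest]
  calc ((j : ℝ) + 1) * kthLargest x j = ∑ _i ∈ Finset.Iic j, kthLargest x j := by simp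
    _ ≤ ∑ i ∈ Finset.Iic j, kthLargest x i :=
      Finset.sum_le_sum fun i hi => kthLargest_antitone x (Finset.mem_Iic.mp hi)
    _ ≤ ∑ i, kthLargest x i :=
      Finset.sum_le_sum_of_subset_of_nonneg (Finset.subset_univ _) fun i _ _ => hx _

lemma le_half_one_sub_sqrt {t : ℝ} (h : t ≤ 1 / 4) : t ≤ (1 - √(1 - 4 * t)) / 2 := by
  have : √(1 - 4 * t) ≤ 1 - 2 * t :=
    Real.sqrt_le_iff.mpr ⟨by linarith, by nlinarith [sq_nonneg t]⟩
  linarith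

/-- let `x ∈ ℝⁿ` be a probability vector, `1 ≤ k ≤ n − 1` and
`1 ≤ γ ≤ k/4`. If `g₁(x) ≤ γ · g_k(x)` (where `g_k(x) = x₍ₖ₎(1 − x₍ₖ₎ + x₍ₖ₊₁₎)` with
1-indexed order statistics), then `‖diag(x) − x xᵀ‖₂ ≤ (1 − √(1 − 4γ/k))/2`. -/
theorem stmt4 {n : ℕ} (x : Fin n → ℝ) (hx : ∀ i, 0 ≤ x i) (hsum : ∑ i, x i = 1)
    (k : ℕ) (hk1 : 1 ≤ k) (hk2 : k + 1 ≤ n)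
    (γ : ℝ) (hγ1 : 1 ≤ γ) (hγ2 : γ ≤ (k : ℝ) / 4)
    (hg : kthLargest x ⟨0, by omega⟩ *
            (1 - kthLargest x ⟨0, by omega⟩ + kthLargest x ⟨1, by omega⟩) ≤
          γ * (kthLargest x ⟨k - 1, by omega⟩ *
            (1 - kthLargest x ⟨k - 1, by omega⟩ + kthLargest x ⟨k, by omega⟩))) :
    specNorm (Matrix.diagonal x - Matrix.vecMulVec x x) ≤
      (1 - Real.sqrt (1 - 4 * γ / (k : ℝ))) / 2 := by
  have hanti := kthLargest_antitone x
  have hk0 : (0 : ℝ) < k := by exact_mod_cast hk1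
  have hnorm : specNorm (Matrix.diagonal x - Matrix.vecMulVec x x) ≤
      kthLargest x ⟨0, by omega⟩ *
        (1 - kthLargest x ⟨0, by omega⟩ + kthLargest x ⟨1, by omega⟩) := by
    refine specNorm_diagonal_sub_vecMulVec_le_s4 hx hsum (hx _)
      (hanti (Fin.mk_le_mk.mpr zero_le_one)) fun i hi => ?_
    obtain ⟨j, hj, hji⟩ := exists_kthLargest_eq x i
    rw [← hj]
    refine hanti (Fin.mk_le_of_le_val (Nat.one_le_iff_ne_zero.mpr fun h => hi ?_))
    rw [← hji, show j = ⟨0, by omega⟩ from Fin.ext h]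
  have hc : kthLargest x ⟨k - 1, by omega⟩ ≤ 1 / k := by
    have h := succ_mul_kthLargest_le_sum hx ⟨k - 1, by omega⟩
    rw [hsum, Nat.cast_sub hk1, Nat.cast_one, sub_add_cancel] at h
    rwa [le_div_iff₀' hk0]
  have hd : kthLargest x ⟨k, by omega⟩ ≤ kthLargest x ⟨k - 1, by omega⟩ :=
    hanti (Fin.mk_le_mk.mpr (Nat.sub_le k 1))
  have hgk : kthLargest x ⟨k - 1, by omega⟩ *
      (1 - kthLargest x ⟨k - 1, by omega⟩ + kthLargest x ⟨k, by omega⟩) ≤ 1 / k :=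
    (mul_le_of_le_one_right (hx _) (by linarith)).trans hc
  calc specNorm (Matrix.diagonal x - Matrix.vecMulVec x x) ≤ γ * (1 / k) :=
        (hnorm.trans hg).trans (mul_le_mul_of_nonneg_left hgk (by linarith))
    _ = γ / k := by ring
    _ ≤ (1 - √(1 - 4 * (γ / k))) / 2 :=
        le_half_one_sub_sqrt (by rw [div_le_iff₀ hk0]; linarith)
    _ = (1 - √(1 - 4 * γ / k)) / 2 := by rw [mul_div_assoc]
end
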